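/- arXiv:2103.09997 — 4 statements merged into one kernel-verified Lean document; each statement's English description precedes it below -/
import Mathlib

section
/- Suppose (θ₀,…,θ₆) ∈ (T³)⁷ is such that among the seven first coordinates θ₀¹,…,θ₆¹ there are exactly 3 distinct values, occurring with multiplicities 5, 1, 1. Then |Θ(θ₀,…,θ₆)| ≤ 1/7. -/
open scoped BigOperators
open scoped Classical

noncomputable section

instance : Fact ((0:ℝ) < 1) := ⟨one_pos⟩

/-- The circle `ℝ/ℤ` with its standard circular order. -/
abbrev S1 : Type := AddCircle (1 : ℝ)

/-- The 3-torus `S¹ × S¹ × S¹`. -/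
abbrev T3 : Type := S1 × S1 × S1

/-- The orientation cocycle on the circle: `1` if `(a,b,c)` are pairwise distinct and
positively oriented, `-1` if pairwise distinct and negatively oriented, `0` otherwise. -/
noncomputable def OrS1 (a b c : S1) : ℝ :=
  if sbtw a b c then 1 else if sbtw c b a then -1 else 0

/-- The cocycle `Θ` on `(T³)⁷`. -/
noncomputable def Theta (θ : Fin 7 → T3) : ℝ :=
  (1 / (Nat.factorial 7 : ℝ)) * ∑ σ : Equiv.Perm (Fin 7),
    ((Equiv.Perm.sign σ : ℤ) : ℝ) *
      (OrS1 (θ (σ 0)).1 (θ (σ 1)).1 (θ (σ 2)).1 *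
       OrS1 (θ (σ 2)).2.1 (θ (σ 3)).2.1 (θ (σ 4)).2.1 *
       OrS1 (θ (σ 4)).2.2 (θ (σ 5)).2.2 (θ (σ 6)).2.2)

lemma OrS1_abs_le_one (a b c : S1) : |OrS1 a b c| ≤ 1 := by
  unfold OrS1
  split_ifs <;> simp

lemma pairwise_ne_of_sbtw {α : Type*} [CircularPreorder α] {a b c : α} (h : sbtw a b c) :
    a ≠ b ∧ b ≠ c ∧ a ≠ c := by
  refine ⟨?_, ?_, ?_⟩ <;> rintro rfl
  · exact sbtw_irrefl_left h
  · exact sbtw_irrefl_right h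
  · exact sbtw_irrefl_left_right h

lemma pairwise_ne_of_OrS1_ne_zero {a b c : S1} (h : OrS1 a b c ≠ 0) :
    a ≠ b ∧ b ≠ c ∧ a ≠ c := by
  unfold OrS1 at h
  split_ifs at h with h₁ h₂
  · exact pairwise_ne_of_sbtw h₁
  · obtain ⟨hcb, hba, hca⟩ := pairwise_ne_of_sbtw h₂
    exact ⟨hba.symm, hcb.symm, hca.symm⟩
  · exact absurd rfl h

/-- The number of permutations of `Fin 7` sending `p` and `q` into `{0, 1, 2}` is `6 * 5!`. -/
lemma card_perm_lt_three {p q : Fin 7} (hpq : p ≠ q) :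
    ∑ σ : Equiv.Perm (Fin 7), (if σ p < 3 ∧ σ q < 3 then 1 else 0 : ℕ) = 720 := by
  set F : Fin 7 → Fin 7 → ℕ := fun x y =>
    ∑ σ : Equiv.Perm (Fin 7), (if σ x < 3 ∧ σ y < 3 then 1 else 0 : ℕ) with hF
  have hconst : ∀ z ∈ (Finset.univ : Finset (Fin 7)).offDiag, F z.1 z.2 = F p q := by
    rintro ⟨x, y⟩ hxy
    have hne : x ≠ y := by simpa using hxy
    have htrans : ∃ π : Equiv.Perm (Fin 7), π p = x ∧ π q = y :=
      MulAction.is_two_pretransitive_iff.mp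
        (Equiv.Perm.isMultiplyPretransitive (Fin 7) 2) hpq hne
    obtain ⟨π, rfl, rfl⟩ := htrans
    exact Fintype.sum_equiv (Equiv.mulRight π) _ _ fun σ => rfl
  have htotal : ∑ z ∈ (Finset.univ : Finset (Fin 7)).offDiag, F z.1 z.2 = 5040 * 6 := by
    rw [hF, Finset.sum_comm]
    have hσ : ∀ σ : Equiv.Perm (Fin 7),
        ∑ z ∈ (Finset.univ : Finset (Fin 7)).offDiag,
          (if σ z.1 < 3 ∧ σ z.2 < 3 then 1 else 0 : ℕ) = 6 := by
      intro σ
      have hreindex : ∑ z ∈ (Finset.univ : Finset (Fin 7)).offDiag,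
          (if σ z.1 < 3 ∧ σ z.2 < 3 then 1 else 0 : ℕ) =
          ∑ z ∈ (Finset.univ : Finset (Fin 7)).offDiag,
            (if z.1 < 3 ∧ z.2 < 3 then 1 else 0 : ℕ) :=
        Finset.sum_equiv (σ.prodCongr σ) (by simp) (by simp)
      rw [hreindex]
      decide
    rw [Finset.sum_congr rfl fun σ _ => hσ σ, Finset.sum_const, Finset.card_univ,
      Fintype.card_perm, Fintype.card_fin, smul_eq_mul]
    rfl
  rw [Finset.sum_congr rfl hconst, Finset.sum_const, Finset.offDiag_card, Finset.card_univ,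
    Fintype.card_fin, smul_eq_mul] at htotal
  change F p q = 720
  omega

lemma inv_apply_lt_three {σ : Equiv.Perm (Fin 7)} {p : Fin 7}
    (h : σ 0 = p ∨ σ 1 = p ∨ σ 2 = p) : σ⁻¹ p < 3 := by
  rcases h with rfl | rfl | rfl <;> simp

/-- If the seven first coordinates take exactly 3 distinct values with multiplicities
`5, 1, 1`, then `|Θ(θ₀,…,θ₆)| ≤ 1/7`. -/
theorem abs_Theta_le_of_mult_511 (θ : Fin 7 → T3) (a b c : S1)
    (hab : a ≠ b) (hac : a ≠ c) (hbc : b ≠ c)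
    (ha : ({j : Fin 7 | (θ j).1 = a}).ncard = 5)
    (hb : ({j : Fin 7 | (θ j).1 = b}).ncard = 1)
    (hc : ({j : Fin 7 | (θ j).1 = c}).ncard = 1) :
    |Theta θ| ≤ 1 / 7 := by
  obtain ⟨p, hp⟩ := Set.ncard_eq_one.mp hb
  obtain ⟨q, hq⟩ := Set.ncard_eq_one.mp hc
  have hp' : ∀ j, (θ j).1 = b ↔ j = p := fun j => Set.ext_iff.mp hp j
  have hq' : ∀ j, (θ j).1 = c ↔ j = q := fun j => Set.ext_iff.mp hq j
  have hpq : p ≠ q := fun h => hbc (((hp' p).mpr rfl).symm.trans ((hq' p).mpr h))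
  have hvalues : ∀ j, (θ j).1 = a ∨ (θ j).1 = b ∨ (θ j).1 = c := by
    have hbc_card : ({j : Fin 7 | (θ j).1 = b} ∪ {j | (θ j).1 = c}).ncard = 2 := by
      rw [Set.ncard_union_eq, hb, hc]
      exact Set.disjoint_left.mpr fun j h₁ h₂ => hbc (h₁.symm.trans h₂)
    have hcard : ({j : Fin 7 | (θ j).1 = a} ∪
        ({j | (θ j).1 = b} ∪ {j | (θ j).1 = c})).ncard = 7 := by
      rw [Set.ncard_union_eq, ha, hbc_card]
      refine Set.disjoint_left.mpr ?_
      rintro j h₁ (h₂ | h₂)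
      · exact hab (h₁.symm.trans h₂)
      · exact hac (h₁.symm.trans h₂)
    have huniv := Set.eq_of_subset_of_ncard_le (Set.subset_univ _)
      (by rw [hcard, Set.ncard_univ, Nat.card_fin])
    exact fun j => Set.eq_univ_iff_forall.mp huniv j
  have hterm : ∀ σ : Equiv.Perm (Fin 7),
      |((Equiv.Perm.sign σ : ℤ) : ℝ) *
        (OrS1 (θ (σ 0)).1 (θ (σ 1)).1 (θ (σ 2)).1 *
         OrS1 (θ (σ 2)).2.1 (θ (σ 3)).2.1 (θ (σ 4)).2.1 *
         OrS1 (θ (σ 4)).2.2 (θ (σ 5)).2.2 (θ (σ 6)).2.2)| ≤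
      ((if σ⁻¹ p < 3 ∧ σ⁻¹ q < 3 then 1 else 0 : ℕ) : ℝ) := by
    intro σ
    by_cases h0 : OrS1 (θ (σ 0)).1 (θ (σ 1)).1 (θ (σ 2)).1 = 0
    · simp only [h0, zero_mul, mul_zero, abs_zero]
      positivity
    · obtain ⟨h01, h12, h02⟩ := pairwise_ne_of_OrS1_ne_zero h0
      have hb_mem : σ 0 = p ∨ σ 1 = p ∨ σ 2 = p := by
        rw [← hp', ← hp', ← hp']
        have := hvalues (σ 0); have := hvalues (σ 1); have := hvalues (σ 2)
        grind
      have hc_mem : σ 0 = q ∨ σ 1 = q ∨ σ 2 = q := by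
        rw [← hq', ← hq', ← hq']
        have := hvalues (σ 0); have := hvalues (σ 1); have := hvalues (σ 2)
        grind
      rw [if_pos ⟨inv_apply_lt_three hb_mem, inv_apply_lt_three hc_mem⟩]
      have hsign : |((Equiv.Perm.sign σ : ℤ) : ℝ)| = 1 := by
        rcases Int.units_eq_one_or (Equiv.Perm.sign σ) with h | h <;> simp [h]
      rw [abs_mul, abs_mul, abs_mul, hsign, one_mul, Nat.cast_one]
      exact mul_le_one₀ (mul_le_one₀ (OrS1_abs_le_one _ _ _) (abs_nonneg _)
        (OrS1_abs_le_one _ _ _)) (abs_nonneg _) (OrS1_abs_le_one _ _ _)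
  have hcount : ∑ σ : Equiv.Perm (Fin 7),
      (if σ⁻¹ p < 3 ∧ σ⁻¹ q < 3 then 1 else 0 : ℕ) = 720 := by
    rw [← card_perm_lt_three hpq]
    exact Equiv.sum_comp (Equiv.inv (Equiv.Perm (Fin 7)))
      fun σ => (if σ p < 3 ∧ σ q < 3 then 1 else 0 : ℕ)
  have hsum := (Finset.abs_sum_le_sum_abs _ _).trans
    (Finset.sum_le_sum fun (σ : Equiv.Perm (Fin 7)) (_ : σ ∈ Finset.univ) => hterm σ)
  rw [← Nat.cast_sum, hcount] at hsum
  have hfact : (Nat.factorial 7 : ℝ) = 5040 := by norm_num [Nat.factorial]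
  rw [Theta, abs_mul, hfact, abs_of_pos (by norm_num : (0 : ℝ) < 1 / 5040)]
  push_cast at hsum
  linarith
end
end

section
/- Suppose (θ₀,…,θ₆) ∈ (T³)⁷ is such that among the seven first coordinates θ₀¹,…,θ₆¹ there are at most 2 distinct values. Then Θ(θ₀,…,θ₆) = 0. -/
open scoped BigOperators
open scoped Classical

noncomputable section

/-- The orientation cocycle vanishes on triples that are not pairwise distinct. -/
theorem OrS1_eq_zero_of_not_pairwise_ne {a b c : S1} (h : a = b ∨ b = c ∨ a = c) :
    OrS1 a b c = 0 := by
  rcases h with rfl | rfl | rfl <;>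
    simp [OrS1, sbtw_irrefl_left_right, sbtw_irrefl_left, sbtw_irrefl_right]

/-- Among three elements of a set with at most two elements, two coincide. -/
theorem eq_or_eq_or_eq_of_ncard_le_two {α : Type*} {s : Set α} (hs : s.Finite)
    (h : s.ncard ≤ 2) {a b c : α} (ha : a ∈ s) (hb : b ∈ s) (hc : c ∈ s) :
    a = b ∨ b = c ∨ a = c := by
  by_contra! hne
  have hsub : ({a, b, c} : Set α) ⊆ s := by
    simp [Set.insert_subset_iff, ha, hb, hc]
  have hcard : ({a, b, c} : Set α).ncard = 3 :=
    Set.ncard_eq_three.mpr ⟨a, b, c, hne.1, hne.2.2, hne.2.1, rfl⟩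
  have hle := Set.ncard_le_ncard hsub hs
  omega

/-- If the seven first coordinates take at most 2 distinct values, then `Θ(θ₀,…,θ₆) = 0`. -/
theorem Theta_eq_zero_of_le_two_distinct (θ : Fin 7 → T3)
    (h : (Set.range fun j => (θ j).1).ncard ≤ 2) :
    Theta θ = 0 := by
  have hOr (i j k : Fin 7) : OrS1 (θ i).1 (θ j).1 (θ k).1 = 0 :=
    OrS1_eq_zero_of_not_pairwise_ne <| eq_or_eq_or_eq_of_ncard_le_two
      (Set.finite_range fun j => (θ j).1) h ⟨i, rfl⟩ ⟨j, rfl⟩ ⟨k, rfl⟩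
  simp [Theta, hOr]
end
end

section
/- Suppose (θ₀,…,θ₆) ∈ (T³)⁷ is such that among the seven first coordinates θ₀¹,…,θ₆¹ there are exactly 4 distinct values, occurring with multiplicities 4, 1, 1, 1, and such that the seven points θ₀²,…,θ₆² are pairwise distinct and the seven points θ₀³,…,θ₆³ are pairwise distinct. Then |Θ(θ₀,…,θ₆)| ≤ 2/15. -/
open scoped BigOperators
open scoped Classical

noncomputable section

lemma OrS1_rotate (x y z : S1) : OrS1 y z x = OrS1 x y z := by
  have h1 : sbtw y z x ↔ sbtw x y z := sbtw_cyclic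
  have h2 : sbtw x z y ↔ sbtw z y x := sbtw_cyclic.symm
  simp only [OrS1, h1, h2]

lemma OrS1_reverse (x y z : S1) : OrS1 z y x = -OrS1 x y z := by
  have h : sbtw x y z → ¬ sbtw z y x := fun h => h.not_sbtw
  unfold OrS1
  split_ifs <;> simp_all

lemma OrS1_swap (p x y : S1) : OrS1 p y x = -OrS1 p x y := by
  rw [← OrS1_reverse, ← OrS1_rotate]

lemma OrS1_self_right (p x : S1) : OrS1 p x x = 0 := by
  have h := OrS1_swap p x x
  linarith

lemma OrS1_self_left (p x : S1) : OrS1 p p x = 0 := by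
  rw [OrS1_rotate x p p, OrS1_self_right]

lemma OrS1_self_outer (p x : S1) : OrS1 p x p = 0 := by
  rw [OrS1_rotate p p x, OrS1_self_left]

lemma sbtw_reverse_iff {x y z : S1} (hxy : x ≠ y) (hyz : y ≠ z) (hzx : z ≠ x) :
    sbtw z y x ↔ ¬ sbtw x y z := by
  refine ⟨fun h => h.not_sbtw, fun h => ?_⟩
  rw [sbtw_iff_not_btw, not_not] at h
  rw [sbtw_iff_not_btw]
  intro h'
  rcases btw_antisymm h' h with h | h | h
  · exact hxy h
  · exact hyz h
  · exact hzx h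

lemma OrS1_eq_one_or_neg_one {x y z : S1} (hxy : x ≠ y) (hyz : y ≠ z) (hzx : z ≠ x) :
    OrS1 x y z = 1 ∨ OrS1 x y z = -1 := by
  by_cases h : sbtw x y z <;> simp [OrS1, sbtw_reverse_iff hxy hyz hzx, h]

lemma OrS1_cocycle (p x y z : S1) :
    OrS1 x y z = OrS1 p x y + OrS1 p y z + OrS1 p z x := by
  by_cases hxy : x = y
  · subst hxy
    simp [OrS1_self_left, OrS1_self_right, OrS1_swap p x z]
  by_cases hyz : y = z
  · subst hyz
    simp [OrS1_self_right, OrS1_swap p x y]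
  by_cases hzx : z = x
  · subst hzx
    simp [OrS1_self_right, OrS1_self_outer, OrS1_swap p y z]
  by_cases hpx : p = x
  · subst hpx
    simp [OrS1_self_left, OrS1_self_outer]
  by_cases hpy : p = y
  · subst hpy
    simp [OrS1_self_left, OrS1_self_outer, ← OrS1_rotate x p z]
  by_cases hpz : p = z
  · subst hpz
    simp [OrS1_self_left, OrS1_self_outer, OrS1_rotate p x y]
  have total : ∀ a b c : S1, a ≠ b → b ≠ c → c ≠ a → (sbtw c b a ↔ ¬ sbtw a b c) :=
    fun _ _ _ => sbtw_reverse_iff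
  have tr : ∀ a b c d : S1, sbtw a b c → sbtw b d c → sbtw a d c :=
    fun a b c d => sbtw_trans_left
  have rot : ∀ a b c : S1, sbtw a b c ↔ sbtw b c a := fun a b c => sbtw_cyclic.symm
  rw [OrS1_swap p x z]
  have t1 := sbtw_reverse_iff hpx hxy (Ne.symm hpy)
  have t2 := sbtw_reverse_iff hpy hyz (Ne.symm hpz)
  have t3 := sbtw_reverse_iff hpx (Ne.symm hzx) (Ne.symm hpz)
  have t4 := sbtw_reverse_iff hxy hyz hzx
  simp only [OrS1, t1, t2, t3, t4]
  clear t1 t2 t3 t4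
  by_cases s1 : sbtw p x y <;> by_cases s2 : sbtw p y z <;> by_cases s3 : sbtw p x z <;>
    by_cases s4 : sbtw x y z <;> simp only [s1, s2, s3, s4] <;> norm_num <;> grind

/-- The signed sum of `F` over all permutations of `Fin n`. -/
def altSum {n : ℕ} (F : (Fin n → Fin n) → ℝ) : ℝ :=
  ∑ σ : Equiv.Perm (Fin n), ((Equiv.Perm.sign σ : ℤ) : ℝ) * F σ

lemma altSum_comp_right {n : ℕ} (π : Equiv.Perm (Fin n)) (F : (Fin n → Fin n) → ℝ) :
    altSum (fun x => F (x ∘ π)) = ((Equiv.Perm.sign π : ℤ) : ℝ) * altSum F := by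
  unfold altSum
  rw [Finset.mul_sum, ← Equiv.sum_comp (Equiv.mulRight π) fun σ => _ * (_ * F σ)]
  refine Finset.sum_congr rfl fun σ _ => ?_
  simp only [Equiv.coe_mulRight, Equiv.Perm.sign_mul, Equiv.Perm.coe_mul, Units.val_mul,
    Int.cast_mul]
  rcases Int.units_eq_one_or (Equiv.Perm.sign π) with h | h <;> simp [h]

lemma altSum_comp_left {n : ℕ} (π : Equiv.Perm (Fin n)) (F : (Fin n → Fin n) → ℝ) :
    altSum (fun x => F (π ∘ x)) = ((Equiv.Perm.sign π : ℤ) : ℝ) * altSum F := by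
  unfold altSum
  rw [Finset.mul_sum, ← Equiv.sum_comp (Equiv.mulLeft π) fun σ => _ * (_ * F σ)]
  refine Finset.sum_congr rfl fun σ _ => ?_
  simp only [Equiv.coe_mulLeft, Equiv.Perm.sign_mul, Equiv.Perm.coe_mul, Units.val_mul,
    Int.cast_mul]
  rcases Int.units_eq_one_or (Equiv.Perm.sign π) with h | h <;> simp [h]

lemma altSum_add {n : ℕ} (F G : (Fin n → Fin n) → ℝ) :
    altSum (fun x => F x + G x) = altSum F + altSum G := by
  simp only [altSum, mul_add, Finset.sum_add_distrib]

lemma altSum_succ {n : ℕ} (F : (Fin (n + 1) → Fin (n + 1)) → ℝ) :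
    altSum F = ∑ p, (if p = 0 then 1 else -1) *
      altSum fun y => F (Fin.cons p fun i => Equiv.swap 0 p (y i).succ) := by
  unfold altSum
  rw [← Equiv.sum_comp Equiv.Perm.decomposeFin.symm, Fintype.sum_prod_type]
  refine Finset.sum_congr rfl fun p _ => ?_
  rw [Finset.mul_sum]
  refine Finset.sum_congr rfl fun e _ => ?_
  rw [Equiv.Perm.decomposeFin.symm_sign, ← mul_assoc]
  congr 2
  · split_ifs <;> simp
  · funext i
    refine Fin.cases ?_ (fun j => ?_) i <;> simp

lemma altSum_fin_zero (F : (Fin 0 → Fin 0) → ℝ) : altSum F = F Fin.elim0 := by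
  simp only [altSum, Finset.univ_unique, Finset.sum_singleton]
  simp [Subsingleton.elim (_ : Fin 0 → Fin 0) Fin.elim0]

/-- Only the permutations fixing `0` contribute to an alternating sum supported on them. -/
lemma altSum_fix_zero {n : ℕ} (F : (Fin (n + 1) → Fin (n + 1)) → ℝ)
    (hF : ∀ σ : Equiv.Perm (Fin (n + 1)), σ 0 ≠ 0 → F σ = 0) :
    altSum F = altSum fun y => F (Fin.cons 0 fun i => (y i).succ) := by
  rw [altSum_succ, Finset.sum_eq_single 0]
  · simp
  · intro p _ hp
    have h0 : ∀ e : Equiv.Perm (Fin n),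
        F (Fin.cons p fun i => Equiv.swap 0 p (e i).succ) = 0 := by
      intro e
      rw [← hF (Equiv.Perm.decomposeFin.symm (p, e)) (by simpa using hp)]
      congr 1
      funext i
      refine Fin.cases ?_ (fun j => ?_) i <;> simp
    simp [h0, altSum]
  · simp

/-- The alternating sum of a product of three two-variable functions evaluated at the
positions listed by `e`. -/
def pairing (f h g : Fin 7 → Fin 7 → ℝ) (e : Fin 6 → Fin 7) : ℝ :=
  altSum fun x => f (x (e 0)) (x (e 1)) * h (x (e 2)) (x (e 3)) * g (x (e 4)) (x (e 5))

lemma pairing_comp (f h g : Fin 7 → Fin 7 → ℝ) (e : Fin 6 → Fin 7) (π : Equiv.Perm (Fin 7)) :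
    pairing f h g (π ∘ e) = ((Equiv.Perm.sign π : ℤ) : ℝ) * pairing f h g e :=
  altSum_comp_right π fun x =>
    f (x (e 0)) (x (e 1)) * h (x (e 2)) (x (e 3)) * g (x (e 4)) (x (e 5))

lemma pairing_eq_of_even (f h g : Fin 7 → Fin 7 → ℝ) {e e' : Fin 6 → Fin 7}
    (π : Equiv.Perm (Fin 7)) (he : π ∘ e = e') (hπ : Equiv.Perm.sign π = 1) :
    pairing f h g e' = pairing f h g e := by
  rw [← he, pairing_comp, hπ]
  simp

lemma pairing_eq_zero (f h g : Fin 7 → Fin 7 → ℝ) {e : Fin 6 → Fin 7} (p q : Fin 7)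
    (hpq : p ≠ q) (he : Equiv.swap p q ∘ e = e) : pairing f h g e = 0 := by
  have h1 := pairing_comp f h g e (Equiv.swap p q)
  rw [he, Equiv.Perm.sign_swap hpq] at h1
  push_cast at h1
  linarith

lemma altSum_mul_cyclic_cyclic (f h g : Fin 7 → Fin 7 → ℝ) :
    altSum (fun x => f (x 0) (x 1) *
      (h (x 2) (x 3) + h (x 3) (x 4) + h (x 4) (x 2)) *
      (g (x 4) (x 5) + g (x 5) (x 6) + g (x 6) (x 4))) =
    5 * pairing f h g ![0, 1, 3, 4, 5, 6] := by
  have key : altSum (fun x => f (x 0) (x 1) *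
      (h (x 2) (x 3) + h (x 3) (x 4) + h (x 4) (x 2)) *
      (g (x 4) (x 5) + g (x 5) (x 6) + g (x 6) (x 4))) =
      pairing f h g ![0, 1, 2, 3, 4, 5] + pairing f h g ![0, 1, 2, 3, 5, 6] +
      pairing f h g ![0, 1, 2, 3, 6, 4] + pairing f h g ![0, 1, 3, 4, 4, 5] +
      pairing f h g ![0, 1, 3, 4, 5, 6] + pairing f h g ![0, 1, 3, 4, 6, 4] +
      pairing f h g ![0, 1, 4, 2, 4, 5] + pairing f h g ![0, 1, 4, 2, 5, 6] +
      pairing f h g ![0, 1, 4, 2, 6, 4] := by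
    unfold pairing
    simp only [← altSum_add]
    congr 1
    funext x
    simp
    ring
  rw [key,
    pairing_eq_of_even f h g (e := ![0, 1, 3, 4, 5, 6]) (e' := ![0, 1, 2, 3, 4, 5])
      c[2, 6, 5, 4, 3] (by decide) (by decide),
    pairing_eq_of_even f h g (e := ![0, 1, 3, 4, 5, 6]) (e' := ![0, 1, 2, 3, 5, 6])
      c[2, 4, 3] (by decide) (by decide),
    pairing_eq_of_even f h g (e := ![0, 1, 3, 4, 5, 6]) (e' := ![0, 1, 2, 3, 6, 4])
      c[2, 5, 6, 4, 3] (by decide) (by decide),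
    pairing_eq_of_even f h g (e := ![0, 1, 3, 4, 5, 6]) (e' := ![0, 1, 4, 2, 5, 6])
      c[2, 3, 4] (by decide) (by decide),
    pairing_eq_zero f h g (e := ![0, 1, 3, 4, 4, 5]) 2 6 (by decide) (by decide),
    pairing_eq_zero f h g (e := ![0, 1, 3, 4, 6, 4]) 2 5 (by decide) (by decide),
    pairing_eq_zero f h g (e := ![0, 1, 4, 2, 4, 5]) 3 6 (by decide) (by decide),
    pairing_eq_zero f h g (e := ![0, 1, 4, 2, 6, 4]) 3 5 (by decide) (by decide)]
  ring

lemma altSum_cyclic_cyclic_cyclic (f h g : Fin 7 → Fin 7 → ℝ) :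
    altSum (fun x => (f (x 0) (x 1) + f (x 1) (x 2) + f (x 2) (x 0)) *
      (h (x 2) (x 3) + h (x 3) (x 4) + h (x 4) (x 2)) *
      (g (x 4) (x 5) + g (x 5) (x 6) + g (x 6) (x 4))) =
    7 * pairing f h g ![0, 1, 3, 4, 5, 6] := by
  have key : altSum (fun x => (f (x 0) (x 1) + f (x 1) (x 2) + f (x 2) (x 0)) *
      (h (x 2) (x 3) + h (x 3) (x 4) + h (x 4) (x 2)) *
      (g (x 4) (x 5) + g (x 5) (x 6) + g (x 6) (x 4))) =
      altSum (fun x => f (x 0) (x 1) *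
        (h (x 2) (x 3) + h (x 3) (x 4) + h (x 4) (x 2)) *
        (g (x 4) (x 5) + g (x 5) (x 6) + g (x 6) (x 4))) +
      pairing f h g ![1, 2, 2, 3, 4, 5] + pairing f h g ![1, 2, 2, 3, 5, 6] +
      pairing f h g ![1, 2, 2, 3, 6, 4] + pairing f h g ![1, 2, 3, 4, 4, 5] +
      pairing f h g ![1, 2, 3, 4, 5, 6] + pairing f h g ![1, 2, 3, 4, 6, 4] +
      pairing f h g ![1, 2, 4, 2, 4, 5] + pairing f h g ![1, 2, 4, 2, 5, 6] +
      pairing f h g ![1, 2, 4, 2, 6, 4] + pairing f h g ![2, 0, 2, 3, 4, 5] +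
      pairing f h g ![2, 0, 2, 3, 5, 6] + pairing f h g ![2, 0, 2, 3, 6, 4] +
      pairing f h g ![2, 0, 3, 4, 4, 5] + pairing f h g ![2, 0, 3, 4, 5, 6] +
      pairing f h g ![2, 0, 3, 4, 6, 4] + pairing f h g ![2, 0, 4, 2, 4, 5] +
      pairing f h g ![2, 0, 4, 2, 5, 6] + pairing f h g ![2, 0, 4, 2, 6, 4] := by
    unfold pairing
    simp only [← altSum_add]
    congr 1
    funext x
    simp
    ring
  rw [key, altSum_mul_cyclic_cyclic,
    pairing_eq_of_even f h g (e := ![0, 1, 3, 4, 5, 6]) (e' := ![1, 2, 3, 4, 5, 6])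
      c[0, 1, 2] (by decide) (by decide),
    pairing_eq_of_even f h g (e := ![0, 1, 3, 4, 5, 6]) (e' := ![2, 0, 3, 4, 5, 6])
      c[0, 2, 1] (by decide) (by decide),
    pairing_eq_zero f h g (e := ![1, 2, 2, 3, 4, 5]) 0 6 (by decide) (by decide),
    pairing_eq_zero f h g (e := ![1, 2, 2, 3, 5, 6]) 0 4 (by decide) (by decide),
    pairing_eq_zero f h g (e := ![1, 2, 2, 3, 6, 4]) 0 5 (by decide) (by decide),
    pairing_eq_zero f h g (e := ![1, 2, 3, 4, 4, 5]) 0 6 (by decide) (by decide),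
    pairing_eq_zero f h g (e := ![1, 2, 3, 4, 6, 4]) 0 5 (by decide) (by decide),
    pairing_eq_zero f h g (e := ![1, 2, 4, 2, 4, 5]) 0 3 (by decide) (by decide),
    pairing_eq_zero f h g (e := ![1, 2, 4, 2, 5, 6]) 0 3 (by decide) (by decide),
    pairing_eq_zero f h g (e := ![1, 2, 4, 2, 6, 4]) 0 3 (by decide) (by decide),
    pairing_eq_zero f h g (e := ![2, 0, 2, 3, 4, 5]) 1 6 (by decide) (by decide),
    pairing_eq_zero f h g (e := ![2, 0, 2, 3, 5, 6]) 1 4 (by decide) (by decide),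
    pairing_eq_zero f h g (e := ![2, 0, 2, 3, 6, 4]) 1 5 (by decide) (by decide),
    pairing_eq_zero f h g (e := ![2, 0, 3, 4, 4, 5]) 1 6 (by decide) (by decide),
    pairing_eq_zero f h g (e := ![2, 0, 3, 4, 6, 4]) 1 5 (by decide) (by decide),
    pairing_eq_zero f h g (e := ![2, 0, 4, 2, 4, 5]) 1 3 (by decide) (by decide),
    pairing_eq_zero f h g (e := ![2, 0, 4, 2, 5, 6]) 1 3 (by decide) (by decide),
    pairing_eq_zero f h g (e := ![2, 0, 4, 2, 6, 4]) 1 3 (by decide) (by decide)]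
  ring

lemma altSum_perm_four (h g : Fin 4 → Fin 4 → ℝ) (hh : ∀ i j, h j i = -h i j)
    (hg : ∀ i j, g j i = -g i j) :
    altSum (fun x : Fin 4 → Fin 4 => h (x 0) (x 1) * g (x 2) (x 3)) =
    4 * (h 0 1 * g 2 3 - h 0 2 * g 1 3 + h 0 3 * g 1 2 +
      h 2 3 * g 0 1 - h 1 3 * g 0 2 + h 1 2 * g 0 3) := by
  have e₄ : ∀ p q : Fin 4, Equiv.swap 0 p q = if q = 0 then p else if q = p then 0 else q :=
    fun _ _ => rfl
  have e₃ : ∀ p q : Fin 3, Equiv.swap 0 p q = if q = 0 then p else if q = p then 0 else q :=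
    fun _ _ => rfl
  have c : ∀ (n m : ℕ) (p : Fin m) (y : Fin n → Fin m),
    (Fin.cons p y : Fin (n + 1) → Fin m) = Matrix.vecCons p y := fun _ _ _ _ => rfl
  simp [altSum_succ, altSum_fin_zero, Fin.sum_univ_succ, c, e₄, e₃]
  rw [hh 0 1, hh 0 2, hh 0 3, hh 1 2, hh 1 3, hh 2 3, hg 0 1, hg 0 2, hg 0 3, hg 1 2, hg 1 3,
    hg 2 3]
  ring

/-- A `±1`-valued antisymmetric function coming from a linear order. -/
structure IsLinearSign {ι : Type*} (h : ι → ι → ℝ) : Prop where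
  swap : ∀ i j, h j i = -h i j
  eq_one_or : ∀ i j, i ≠ j → h i j = 1 ∨ h i j = -1
  abs_cyclic_le : ∀ i j k, i ≠ j → j ≠ k → k ≠ i → |h i j + h j k - h i k| ≤ 1

lemma isLinearSign_OrS1 {ι : Type*} {p : S1} {x : ι → S1} (hx : Function.Injective x)
    (hp : ∀ i, p ≠ x i) : IsLinearSign fun i j => OrS1 p (x i) (x j) where
  swap i j := OrS1_swap _ _ _
  eq_one_or i j hij := OrS1_eq_one_or_neg_one (hp i) (hx.ne hij) (hp j).symm
  abs_cyclic_le i j k hij hjk hki := by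
    have h := OrS1_cocycle p (x i) (x j) (x k)
    rw [OrS1_swap p (x i) (x k), ← sub_eq_add_neg] at h
    rw [← h]
    rcases OrS1_eq_one_or_neg_one (hx.ne hij) (hx.ne hjk) (hx.ne hki) with h | h <;> simp [h]

lemma IsLinearSign.abs_altSum_le {h g : Fin 4 → Fin 4 → ℝ} (hh : IsLinearSign h)
    (hg : IsLinearSign g) :
    |altSum (fun x : Fin 4 → Fin 4 => h (x 0) (x 1) * g (x 2) (x 3))| ≤ 16 := by
  rw [altSum_perm_four h g hh.swap hg.swap]
  have cyc : ∀ {s : Fin 4 → Fin 4 → ℝ}, IsLinearSign s → ∀ i j k, i ≠ j → j ≠ k → k ≠ i →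
      -1 ≤ s i j + s j k - s i k ∧ s i j + s j k - s i k ≤ 1 :=
    fun hs i j k h₁ h₂ h₃ => abs_le.1 (hs.abs_cyclic_le i j k h₁ h₂ h₃)
  have bd : ∀ i j, i ≠ j → -1 ≤ g i j ∧ g i j ≤ 1 := by
    intro i j hij
    rcases hg.eq_one_or i j hij with h | h <;> rw [h] <;> norm_num
  have a1 := cyc hh 0 1 2 (by decide) (by decide) (by decide)
  have a2 := cyc hh 0 1 3 (by decide) (by decide) (by decide)
  have a3 := cyc hh 0 2 3 (by decide) (by decide) (by decide)
  have a4 := cyc hh 1 2 3 (by decide) (by decide) (by decide)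
  obtain ⟨b1, b1'⟩ := cyc hg 0 1 2 (by decide) (by decide) (by decide)
  obtain ⟨b2, b2'⟩ := cyc hg 0 1 3 (by decide) (by decide) (by decide)
  obtain ⟨b3, b3'⟩ := cyc hg 0 2 3 (by decide) (by decide) (by decide)
  obtain ⟨b4, b4'⟩ := cyc hg 1 2 3 (by decide) (by decide) (by decide)
  obtain ⟨c1, c1'⟩ := bd 0 1 (by decide)
  obtain ⟨c2, c2'⟩ := bd 0 2 (by decide)
  obtain ⟨c3, c3'⟩ := bd 0 3 (by decide)
  obtain ⟨c4, c4'⟩ := bd 1 2 (by decide)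
  obtain ⟨c5, c5'⟩ := bd 1 3 (by decide)
  obtain ⟨c6, c6'⟩ := bd 2 3 (by decide)
  rw [abs_le]
  rcases hh.eq_one_or 0 1 (by decide) with d1 | d1 <;>
  rcases hh.eq_one_or 0 2 (by decide) with d2 | d2 <;>
  rcases hh.eq_one_or 1 2 (by decide) with d3 | d3 <;>
  rw [d1, d2, d3] at a1 <;> norm_num at a1 <;>
  rcases hh.eq_one_or 0 3 (by decide) with d4 | d4 <;>
  rcases hh.eq_one_or 1 3 (by decide) with d5 | d5 <;>
  rw [d1, d4, d5] at a2 <;> norm_num at a2 <;>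
  rcases hh.eq_one_or 2 3 (by decide) with d6 | d6 <;>
  rw [d2, d4, d6] at a3 <;> norm_num at a3 <;>
  rw [d3, d5, d6] at a4 <;> norm_num at a4 <;>
  rw [d1, d2, d3, d4, d5, d6] <;> constructor <;> linarith

lemma abs_pairing_single_le {y z : Fin 7 → S1} (hy : Function.Injective y)
    (hz : Function.Injective z) {u v p : Fin 7} (huv : u ≠ v) (hup : u ≠ p) (hvp : v ≠ p) :
    |pairing (fun i j => if i = u ∧ j = v then 1 else 0) (fun i j => OrS1 (y p) (y i) (y j))
      (fun i j => OrS1 (z p) (z i) (z j)) ![0, 1, 3, 4, 5, 6]| ≤ 16 := by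
  have hinj : Function.Injective ![u, v, p] := by
    intro i j
    fin_cases i <;> fin_cases j <;> simp [huv, hup, hvp, huv.symm, hup.symm, hvp.symm]
  have : MulAction.IsPretransitive (Equiv.Perm (Fin 7)) (Fin 3 ↪ Fin 7) :=
    Equiv.Perm.isMultiplyPretransitive (Fin 7) 3
  obtain ⟨ρ, hρ⟩ := MulAction.exists_smul_eq (Equiv.Perm (Fin 7))
    (Fin.castLEEmb (show 3 ≤ 7 by norm_num)) ⟨_, hinj⟩
  have h0 : ρ 0 = u := DFunLike.congr_fun hρ 0
  have h1 : ρ 1 = v := DFunLike.congr_fun hρ 1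
  have h2 : ρ 2 = p := DFunLike.congr_fun hρ 2
  subst h0 h1 h2
  have habs : ∀ F : (Fin 7 → Fin 7) → ℝ, |altSum F| = |altSum fun x => F (ρ ∘ x)| := by
    intro F
    rw [altSum_comp_left, abs_mul]
    rcases Int.units_eq_one_or (Equiv.Perm.sign ρ) with h | h <;> simp [h]
  rw [pairing, habs, altSum_fix_zero, altSum_fix_zero, altSum_fix_zero]
  · have hk : Function.Injective fun i : Fin 4 => ρ i.succ.succ.succ := fun i j hij => by
      simpa using hij
    have hρk : ∀ i : Fin 4, ρ 2 ≠ ρ i.succ.succ.succ := fun i => ρ.injective.ne (by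
      fin_cases i <;> decide)
    have hY := isLinearSign_OrS1 (hy.comp hk) fun i => hy.ne (hρk i)
    have hZ := isLinearSign_OrS1 (hz.comp hk) fun i => hz.ne (hρk i)
    convert hY.abs_altSum_le hZ using 3
    funext x
    rw [if_pos ⟨rfl, rfl⟩, one_mul]
    rfl
  · intro σ hσ
    change (if _ then _ else _) *
      OrS1 (y (ρ 2)) (y (ρ (σ 1).succ.succ)) (y (ρ (σ 2).succ.succ)) *
      OrS1 (z (ρ 2)) (z (ρ (σ 3).succ.succ)) (z (ρ (σ 4).succ.succ)) = 0
    obtain ⟨k, hk⟩ := σ.surjective 0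
    fin_cases k
    · exact absurd hk hσ
    all_goals
      simp only [Fin.mk_one, Fin.reduceFinMk] at hk
      simp [hk, OrS1_self_left, OrS1_self_outer]
  · intro σ hσ
    have h : ρ (σ 0).succ ≠ ρ 1 := ρ.injective.ne fun h => hσ (Fin.succ_injective _ h)
    rw [if_neg fun h' => h h'.2, zero_mul, zero_mul]
  · intro σ hσ
    have h : ρ (σ 0) ≠ ρ 0 := ρ.injective.ne hσ
    rw [if_neg fun h' => h h'.1, zero_mul, zero_mul]

lemma five_mul_pairing (y z : Fin 7 → S1) (f : Fin 7 → Fin 7 → ℝ) (p : Fin 7) :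
    5 * pairing f (fun i j => OrS1 (y p) (y i) (y j)) (fun i j => OrS1 (z p) (z i) (z j))
      ![0, 1, 3, 4, 5, 6] =
    altSum fun x => f (x 0) (x 1) * OrS1 (y (x 2)) (y (x 3)) (y (x 4)) *
      OrS1 (z (x 4)) (z (x 5)) (z (x 6)) := by
  rw [← altSum_mul_cyclic_cyclic]
  simp only [← OrS1_cocycle]

lemma pairing_eq_sum_single (f h g : Fin 7 → Fin 7 → ℝ) (e : Fin 6 → Fin 7) :
    pairing f h g e =
      ∑ q : Fin 7 × Fin 7, f q.1 q.2 *
        pairing (fun i j => if i = q.1 ∧ j = q.2 then 1 else 0) h g e := by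
  simp only [pairing, altSum, Finset.mul_sum]
  rw [Finset.sum_comm]
  refine Finset.sum_congr rfl fun σ _ => ?_
  rw [Finset.sum_eq_single (σ (e 0), σ (e 1))]
  · simp
    ring
  · rintro ⟨q₁, q₂⟩ _ hq
    rw [if_neg]
    · simp
    · rintro ⟨h₁, h₂⟩
      exact hq (by simp [h₁, h₂])
  · simp

/-- If the seven first coordinates take exactly 4 distinct values with multiplicities
`4, 1, 1, 1`, and the second and third coordinates are each pairwise distinct, then
`|Θ(θ₀,…,θ₆)| ≤ 2/15`. -/
theorem abs_Theta_le_of_mult_4111 (θ : Fin 7 → T3) (a b c d : S1)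
    (hab : a ≠ b) (hac : a ≠ c) (had : a ≠ d)
    (hbc : b ≠ c) (hbd : b ≠ d) (hcd : c ≠ d)
    (ha : ({j : Fin 7 | (θ j).1 = a}).ncard = 4)
    (hb : ({j : Fin 7 | (θ j).1 = b}).ncard = 1)
    (hc : ({j : Fin 7 | (θ j).1 = c}).ncard = 1)
    (hd : ({j : Fin 7 | (θ j).1 = d}).ncard = 1)
    (h2 : Function.Injective fun j => (θ j).2.1)
    (h3 : Function.Injective fun j => (θ j).2.2) :
    |Theta θ| ≤ 2 / 15 := by
  have hsum : Theta θ = 1 / 5040 * altSum (fun x =>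
      OrS1 (θ (x 0)).1 (θ (x 1)).1 (θ (x 2)).1 * OrS1 (θ (x 2)).2.1 (θ (x 3)).2.1 (θ (x 4)).2.1 *
      OrS1 (θ (x 4)).2.2 (θ (x 5)).2.2 (θ (x 6)).2.2) := by
    simp only [Theta, altSum, Nat.factorial]
    norm_num
  set f : Fin 7 → Fin 7 → ℝ := fun i j => OrS1 a (θ i).1 (θ j).1 with hf
  have hpair := altSum_cyclic_cyclic_cyclic f
    (fun i j => OrS1 (θ 0).2.1 (θ i).2.1 (θ j).2.1)
    (fun i j => OrS1 (θ 0).2.2 (θ i).2.2 (θ j).2.2)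
  simp only [hf, ← OrS1_cocycle] at hpair
  rw [hsum, hpair, pairing_eq_sum_single]
  set S : Finset (Fin 7) := {j | (θ j).1 ≠ a}
  have hS : S.card = 3 := by
    have h := Finset.card_filter_add_card_filter_not (s := (Finset.univ : Finset (Fin 7)))
      (fun j => (θ j).1 = a)
    have h' : (Finset.univ.filter fun j : Fin 7 => (θ j).1 = a).card = 4 := by
      rw [← ha, ← Set.ncard_coe_finset]
      simp
    simp only [Finset.card_univ, Fintype.card_fin, h'] at h
    have : S.card = (Finset.univ.filter fun j : Fin 7 => ¬ (θ j).1 = a).card := rfl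
    omega
  rw [← Finset.sum_subset (Finset.subset_univ S.offDiag)]
  · have hle : ∀ q ∈ S.offDiag,
        |f q.1 q.2 * pairing (fun i j => if i = q.1 ∧ j = q.2 then 1 else 0)
        (fun i j => OrS1 (θ 0).2.1 (θ i).2.1 (θ j).2.1)
        (fun i j => OrS1 (θ 0).2.2 (θ i).2.2 (θ j).2.2) ![0, 1, 3, 4, 5, 6]| ≤ 16 := by
      rintro ⟨u, v⟩ hq
      have huv : u ≠ v := (Finset.mem_offDiag.1 hq).2.2
      obtain ⟨p, hup, hvp⟩ : ∃ p : Fin 7, u ≠ p ∧ v ≠ p := by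
        clear hq
        decide +revert
      have hf1 : |f u v| ≤ 1 := by
        simp only [hf, OrS1]
        split_ifs <;> simp
      have hp := abs_pairing_single_le h2 h3 huv hup hvp
      have h5 := five_mul_pairing (fun j => (θ j).2.1) (fun j => (θ j).2.2)
        (fun i j => if i = u ∧ j = v then 1 else 0)
      rw [mul_left_cancel₀ (by norm_num) ((h5 p).trans (h5 0).symm)] at hp
      rw [abs_mul]
      exact (mul_le_of_le_one_left (abs_nonneg _) hf1).trans hp
    have hs := (Finset.abs_sum_le_sum_abs _ _).trans (Finset.sum_le_card_nsmul _ _ _ hle)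
    rw [Finset.offDiag_card, hS] at hs
    norm_num at hs
    rw [abs_mul, abs_mul]
    norm_num
    linarith
  · rintro ⟨u, v⟩ _ hq
    suffices h : f u v = 0 from mul_eq_zero_of_left h _
    simp only [S, Finset.mem_offDiag, Finset.mem_filter, Finset.mem_univ, true_and] at hq
    by_cases hu : (θ u).1 = a
    · simp [f, hu, OrS1_self_left]
    by_cases hv : (θ v).1 = a
    · simp [f, hv, OrS1_self_outer]
    have huv : u = v := by
      by_contra huv
      exact hq ⟨hu, hv, huv⟩
    simp [f, huv, OrS1_self_right]
end
end

section
/- Let ηⱼ = ([j/5], [2j/5]) ∈ T² for j = 0,…,4, where [t] denotes the class of t ∈ ℝ in S¹ = ℝ/ℤ. Then Θ'(η₀,…,η₄) = 2/3. -/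
open scoped BigOperators
open scoped Classical

noncomputable section

/-- The 2-torus `S¹ × S¹`. -/
abbrev T2 : Type := S1 × S1

/-- The cocycle `Θ'` on `(T²)⁵` from Bucher-Karlsson. -/
noncomputable def Theta' (η : Fin 5 → T2) : ℝ :=
  (1 / (Nat.factorial 5 : ℝ)) * ∑ σ : Equiv.Perm (Fin 5),
    ((Equiv.Perm.sign σ : ℤ) : ℝ) *
      (OrS1 (η (σ 0)).1 (η (σ 1)).1 (η (σ 2)).1 *
       OrS1 (η (σ 2)).2 (η (σ 3)).2 (η (σ 4)).2)

theorem toIcoMod_one_of_mem_Ico {c b : ℝ} (hc : c ∈ Set.Ico (0 : ℝ) 1)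
    (hb : b ∈ Set.Ico (0 : ℝ) 1) :
    toIcoMod one_pos c b = if c ≤ b then b else b + 1 := by
  obtain ⟨hc0, hc1⟩ := hc
  obtain ⟨hb0, hb1⟩ := hb
  rw [toIcoMod_eq_iff]
  split_ifs with h
  · exact ⟨⟨h, by linarith⟩, 0, by simp⟩
  · exact ⟨⟨by linarith, by linarith⟩, -1, by simp⟩

theorem toIocMod_one_of_mem_Ico {c b : ℝ} (hc : c ∈ Set.Ico (0 : ℝ) 1)
    (hb : b ∈ Set.Ico (0 : ℝ) 1) :
    toIocMod one_pos c b = if c < b then b else b + 1 := by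
  obtain ⟨hc0, hc1⟩ := hc
  obtain ⟨hb0, hb1⟩ := hb
  rw [toIocMod_eq_iff]
  split_ifs with h
  · exact ⟨⟨h, by linarith⟩, 0, by simp⟩
  · exact ⟨⟨by linarith, by linarith⟩, -1, by simp⟩

/-- The circular order of `ℝ/ℤ` read off on representatives in `[0, 1)`. -/
theorem sbtw_coe_S1_iff {a b c : ℝ} (ha : a ∈ Set.Ico (0 : ℝ) 1) (hb : b ∈ Set.Ico (0 : ℝ) 1)
    (hc : c ∈ Set.Ico (0 : ℝ) 1) :
    sbtw (a : S1) (b : S1) (c : S1) ↔ (a < b ∧ b < c) ∨ (b < c ∧ c < a) ∨ (c < a ∧ a < b) := by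
  rw [sbtw_iff_not_btw, QuotientAddGroup.btw_coe_iff, toIcoMod_one_of_mem_Ico hc hb,
    toIocMod_one_of_mem_Ico hc ha]
  obtain ⟨ha0, ha1⟩ := ha
  obtain ⟨hb0, hb1⟩ := hb
  obtain ⟨hc0, hc1⟩ := hc
  split_ifs <;> grind

/-- The integer-valued orientation cocycle of the cyclically ordered set `Fin n`. -/
def finOrientation {n : ℕ} (i j k : Fin n) : ℤ :=
  if (i < j ∧ j < k) ∨ (j < k ∧ k < i) ∨ (k < i ∧ i < j) then 1
  else if (k < j ∧ j < i) ∨ (j < i ∧ i < k) ∨ (i < k ∧ k < j) then -1 else 0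

theorem OrS1_coe_div {n : ℕ} (i j k : Fin n) :
    OrS1 (((i : ℝ) / n : ℝ) : S1) (((j : ℝ) / n : ℝ) : S1) (((k : ℝ) / n : ℝ) : S1) =
      finOrientation i j k := by
  have hn : (0 : ℝ) < n := by exact_mod_cast i.pos
  have mem (l : Fin n) : (l : ℝ) / n ∈ Set.Ico (0 : ℝ) 1 :=
    ⟨by positivity, by rw [div_lt_one hn]; exact_mod_cast l.isLt⟩
  simp only [OrS1, finOrientation, sbtw_coe_S1_iff (mem _) (mem _) (mem _),
    div_lt_div_iff_of_pos_right hn, Nat.cast_lt, Fin.val_fin_lt]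
  push_cast
  rfl

theorem coe_two_mul_div_five (j : Fin 5) :
    ((2 * (j : ℝ) / 5 : ℝ) : S1) = ((((2 * j : Fin 5) : ℝ) / (5 : ℕ) : ℝ) : S1) := by
  rw [QuotientAddGroup.eq_iff_sub_mem, AddSubgroup.mem_zmultiples_iff]
  refine ⟨((2 * j.val / 5 : ℕ) : ℤ), ?_⟩
  fin_cases j <;> norm_num [Fin.val_mul]

theorem sum_sign_mul_finOrientation_five :
    ∑ σ : Equiv.Perm (Fin 5), (Equiv.Perm.sign σ : ℤ) *
      (finOrientation (σ 0) (σ 1) (σ 2) *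
        finOrientation (2 * σ 2) (2 * σ 3) (2 * σ 4)) = 80 := by
  decide +kernel

/-- At the configuration `ηⱼ = ([j/5], [2j/5])`, the cocycle `Θ'` takes the value `2/3`. -/
theorem Theta'_apply_regular :
    Theta' (fun j : Fin 5 =>
      (((((j : ℝ) / 5) : ℝ) : S1),
       ((((2 * (j : ℝ) / 5) : ℝ)) : S1))) = 2 / 3 := by
  have first (j : Fin 5) : (((j : ℝ) / 5 : ℝ) : S1) = (((j : ℝ) / (5 : ℕ) : ℝ) : S1) := by simp
  simp only [Theta', first, coe_two_mul_div_five, OrS1_coe_div]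
  have h := congrArg (Int.cast : ℤ → ℝ) sum_sign_mul_finOrientation_five
  push_cast at h
  rw [h]
  norm_num [Nat.factorial]
end
end
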